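/- arXiv:1806.01115 — 7 statements merged into one kernel-verified Lean document; each statement's English description precedes it below -/
import Mathlib

section
/- The cochain cohomology of K is concentrated in degree 0: H⁰(K) is 2-dimensional over ℚ, spanned by the classes of u^L₀ and u^R₀, and H^n(K) = 0 for all n ≠ 0. (These are the cohomology dimensions of S⁰, verifying the minimal DG-module model over ℚ[h₃] for the fiberwise suspension spectrum over S³ of the fixed-point inclusion S⁰ → S³.) -/
/-!
# Statement 7

The complex `K` (minimal DG-module model over `ℚ[h₃]` for the fiberwise suspension
spectrum over `S³` of the fixed-point inclusion `S⁰ → S³`) has cohomology concentrated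
in degree 0, where it is 2-dimensional, spanned by the classes of `u^L₀` and `u^R₀`.

The complex is concentrated in non-negative degrees, so it is indexed by `ℕ`;
in degree `0` there are no coboundaries, so `H⁰` is the space of `0`-cocycles,
and the vanishing of `Hⁿ` for `n ≠ 0` is expressed for all degrees `n + 1`.
-/

noncomputable section

namespace Stmt7

/-- Index for the basis of `K`: `(side, ε, p)` encodes `h₃^ε u^{side}_{2p}`,
with `side = true` for `L` and `side = false` for `R`. -/
abbrev Idx : Type := Bool × Bool × ℕ

/-- Degree of a basis symbol: `3ε + 2p`. -/
def deg : Idx → ℕ := fun q => 3 * q.2.1.toNat + 2 * q.2.2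

/-- Basis of the degree-`n` component of `K`. -/
abbrev B (n : ℕ) : Type := {q : Idx // deg q = n}

/-- The degree-`n` component of the complex `K`. -/
abbrev V (n : ℕ) : Type := B n →₀ ℚ

/-- The differential on basis elements:
`d(u^{L/R}₀) = 0`, `d(u^{L/R}_{2p+2}) = h₃ u^{L/R}_{2p}`, `d(h₃ ⬝) = 0`. -/
def dTarget (n : ℕ) : B n → V (n + 1) := fun b =>
  match b with
  | ⟨(s, false, p + 1), h⟩ =>
      Finsupp.single ⟨(s, true, p), by simp [deg] at h ⊢; omega⟩ 1
  | ⟨(_, false, 0), _⟩ => 0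
  | ⟨(_, true, _), _⟩ => 0

/-- The differential of `K`. -/
def d (n : ℕ) : V n →ₗ[ℚ] V (n + 1) :=
  Finsupp.linearCombination ℚ (dTarget n)

/-- The basis element `u^L₀` in degree `0`. -/
def uL0 : V 0 := Finsupp.single ⟨(true, false, 0), by simp [deg]⟩ 1

/-- The basis element `u^R₀` in degree `0`. -/
def uR0 : V 0 := Finsupp.single ⟨(false, false, 0), by simp [deg]⟩ 1

/-- The contracting homotopy on basis elements: `h₃ u_{2p} ↦ u_{2p+2}`, `u_{2p} ↦ 0`. -/
def hTarget (n : ℕ) : B (n + 1) → V n := fun b =>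
  match b with
  | ⟨(s, true, p), h⟩ =>
      Finsupp.single ⟨(s, false, p + 1), by simp [deg] at h ⊢; omega⟩ 1
  | ⟨(_, false, _), _⟩ => 0

/-- The contracting homotopy in positive degrees. -/
def hmap (n : ℕ) : V (n + 1) →ₗ[ℚ] V n :=
  Finsupp.linearCombination ℚ (hTarget n)

theorem homotopy (n : ℕ) :
    (d n).comp (hmap n) + (hmap (n + 1)).comp (d (n + 1)) = LinearMap.id := by
  apply Finsupp.lhom_ext'
  intro b
  apply LinearMap.ext_ring
  rcases b with ⟨⟨s, e, p⟩, h⟩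
  rcases e with _ | _
  · rcases p with _ | p
    · simp [deg] at h
    · simp [d, hmap, hTarget, dTarget]
  · simp [d, hmap, hTarget, dTarget]

theorem V0_eq (x : V 0) : ∃ a b : ℚ, x = a • uL0 + b • uR0 := by
  refine ⟨x ⟨(true, false, 0), by simp [deg]⟩, x ⟨(false, false, 0), by simp [deg]⟩, ?_⟩
  ext ⟨⟨s, e, p⟩, h⟩
  have he : e = false := by cases e <;> simp [deg] at h ⊢
  subst he
  have hp : p = 0 := by simpa [deg] using h
  subst hp
  cases s <;> simp [uL0, uR0]

/-- The cohomology of `K` is concentrated in degree `0`: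
`H⁰(K)` is 2-dimensional over `ℚ`, spanned by the classes of `u^L₀`, `u^R₀`
(in degree `0` classes of cocycles, since there are no coboundaries there),
and `Hⁿ(K) = 0` for all `n ≠ 0` (every cocycle in positive degree is a coboundary;
in negative degrees the complex vanishes). -/
theorem statement7 :
    LinearMap.ker (d 0) = Submodule.span ℚ {uL0, uR0} ∧
    LinearIndependent ℚ ![uL0, uR0] ∧
    (∀ (n : ℕ) (x : V (n + 1)), d (n + 1) x = 0 → ∃ y : V n, d n y = x) := by
  refine ⟨?_, ?_, ?_⟩
  · apply le_antisymm
    · intro x _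
      obtain ⟨a, b, rfl⟩ := V0_eq x
      exact Submodule.mem_span_pair.2 ⟨a, b, rfl⟩
    · rw [Submodule.span_le]
      rintro x (rfl | rfl)
      · simp [d, uL0, dTarget]
      · simp [d, uR0, dTarget]
  · rw [LinearIndependent.pair_iff]
    intro a b hab
    have h1 := DFunLike.congr_fun hab ⟨(true, false, 0), by simp [deg]⟩
    have h2 := DFunLike.congr_fun hab ⟨(false, false, 0), by simp [deg]⟩
    simp [uL0, uR0] at h1 h2
    exact ⟨h1, h2⟩
  · intro n x hx
    refine ⟨hmap n x, ?_⟩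
    have := LinearMap.congr_fun (homotopy n) x
    simpa [hx] using this

end Stmt7
end
end

section
/- The cochain cohomology of L is: H⁰(L) is 1-dimensional spanned by the class of ω̃₀, H⁴(L) is 1-dimensional spanned by the class of ω₄, and H^n(L) = 0 for all n ∉ {0, 4}. (These are the cohomology dimensions of S⁴, verifying the minimal DG-module model over ℚ[h₃] for the fiberwise suspension spectrum of S⁴ over S³.) -/
/-!
# Statement 8

The complex `L` (minimal DG-module model over `ℚ[h₃]` for the fiberwise suspension
spectrum of `S⁴` over `S³`) has cohomology `H⁰` and `H⁴` one-dimensional, spanned by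
the classes of `ω̃₀` and `ω₄` respectively, and `Hⁿ = 0` otherwise.

The complex is concentrated in non-negative degrees, so it is indexed by `ℕ`;
in degree `0` there are no coboundaries, so `H⁰` is the space of `0`-cocycles,
and the vanishing/cohomology claims in positive degree `n + 1` are stated with
coboundaries coming from degree `n`.
-/

noncomputable section

namespace Stmt8

/-- Index for the basis of `L`: `(knd, ε, p)`; `knd = true` encodes `h₃^ε ω̃_{2p}`
(degree `3ε + 2p`), and `knd = false` encodes `h₃^ε ω_{2p+4}` (degree `3ε + 2p + 4`). -/
abbrev Idx : Type := Bool × Bool × ℕ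

/-- Degree of a basis symbol. -/
def deg : Idx → ℕ := fun q => 3 * q.2.1.toNat + 2 * q.2.2 + 4 * (!q.1).toNat

/-- Basis of the degree-`n` component of `L`. -/
abbrev B (n : ℕ) : Type := {q : Idx // deg q = n}

/-- The degree-`n` component of the complex `L`. -/
abbrev V (n : ℕ) : Type := B n →₀ ℚ

/-- The differential on basis elements:
`d(ω̃₀) = 0`, `d(ω̃_{2p+2}) = h₃ ω̃_{2p}`, `d(ω₄) = 0`,
`d(ω_{2p+6}) = h₃ ω_{2p+4}`, `d(h₃ ⬝) = 0`. -/
def dTarget (n : ℕ) : B n → V (n + 1) := fun b =>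
  match b with
  | ⟨(true, false, p + 1), h⟩ =>
      Finsupp.single ⟨(true, true, p), by simp [deg] at h ⊢; omega⟩ 1
  | ⟨(true, false, 0), _⟩ => 0
  | ⟨(false, false, p + 1), h⟩ =>
      Finsupp.single ⟨(false, true, p), by simp [deg] at h ⊢; omega⟩ 1
  | ⟨(false, false, 0), _⟩ => 0
  | ⟨(_, true, _), _⟩ => 0

/-- The differential of `L`. -/
def d (n : ℕ) : V n →ₗ[ℚ] V (n + 1) :=
  Finsupp.linearCombination ℚ (dTarget n)

/-- The basis element `ω̃₀` in degree `0`. -/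
def tw0 : V 0 := Finsupp.single ⟨(true, false, 0), by simp [deg]⟩ 1

/-- The basis element `ω₄` in degree `4`. -/
def om4 : V 4 := Finsupp.single ⟨(false, false, 0), by simp [deg]⟩ 1

/-- The contracting homotopy on basis elements. -/
def sTarget (n : ℕ) : B (n + 1) → V n := fun b =>
  match b with
  | ⟨(k, true, p), h⟩ =>
      Finsupp.single ⟨(k, false, p + 1), by simp [deg] at h ⊢; omega⟩ 1
  | ⟨(_, false, _), _⟩ => 0

/-- The contracting homotopy. -/
def sMap (n : ℕ) : V (n + 1) →ₗ[ℚ] V n :=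
  Finsupp.linearCombination ℚ (sTarget n)

lemma d_single (n : ℕ) (b : B n) (c : ℚ) :
    d n (Finsupp.single b c) = c • dTarget n b := by
  simp [d]

lemma sMap_single (n : ℕ) (b : B (n + 1)) (c : ℚ) :
    sMap n (Finsupp.single b c) = c • sTarget n b := by
  simp [sMap]

/-- The homotopy formula on basis elements other than `ω₄`. -/
lemma homotopy_basis (n : ℕ) (b : B (n + 1)) (hb : b.1 ≠ (false, false, 0)) :
    d n (sTarget n b) + sMap (n + 1) (dTarget (n + 1) b) = Finsupp.single b 1 := by
  obtain ⟨⟨k, e, p⟩, h⟩ := b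
  cases k <;> cases e <;> cases p <;>
    first
    | exact absurd rfl hb
    | (exfalso; simp [deg] at h; done)
    | simp [sTarget, dTarget, d_single, sMap_single]

lemma homotopy (n : ℕ) (hn : n + 1 ≠ 4) (x : V (n + 1)) :
    d n (sMap n x) + sMap (n + 1) (d (n + 1) x) = x := by
  induction x using Finsupp.induction_linear with
  | zero => simp
  | add x y hx hy =>
    simp only [map_add]
    rw [add_add_add_comm, hx, hy]
  | single b c =>
    have hb : b.1 ≠ (false, false, 0) := by
      intro h
      apply hn
      rw [← b.2, h]
      simp [deg]
    rw [sMap_single, d_single, map_smul, map_smul, ← smul_add, homotopy_basis n b hb]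
    simp

/-- The index of `ω₄`. -/
def b4 : B 4 := ⟨(false, false, 0), by simp [deg]⟩

lemma om4_eq : om4 = Finsupp.single b4 1 := rfl

lemma homotopy_four (x : V 4) :
    d 3 (sMap 3 x) + sMap 4 (d 4 x) + x b4 • om4 = x := by
  induction x using Finsupp.induction_linear with
  | zero => simp
  | add x y hx hy =>
    simp only [map_add, Finsupp.add_apply, add_smul]
    conv_rhs => rw [← hx, ← hy]
    abel
  | single b c =>
    by_cases hb : b = b4
    · subst hb
      have h1 : sTarget 3 b4 = 0 := rfl
      have h2 : dTarget 4 b4 = 0 := rfl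
      rw [sMap_single, d_single, h1, h2, om4_eq]
      simp
    · have hb' : b.1 ≠ (false, false, 0) := fun h => hb (Subtype.ext h)
      have h0 : (Finsupp.single b c : V 4) b4 = 0 := Finsupp.single_eq_of_ne (Ne.symm hb)
      rw [h0, sMap_single, d_single, map_smul, map_smul, ← smul_add, homotopy_basis 3 b hb']
      simp

lemma d_three_apply (y : V 3) : d 3 y b4 = 0 := by
  induction y using Finsupp.induction_linear with
  | zero => simp
  | add x y hx hy => simp [hx, hy]
  | single b c =>
    rw [d_single]
    obtain ⟨⟨k, e, p⟩, h⟩ := b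
    cases k <;> cases e <;> cases p <;> simp [dTarget, b4]

/-- The index of `ω̃₀`. -/
def b0 : B 0 := ⟨(true, false, 0), by simp [deg]⟩

lemma eq_b0 (b : B 0) : b = b0 := by
  apply Subtype.ext
  obtain ⟨⟨k, e, p⟩, h⟩ := b
  cases k <;> cases e <;> cases p <;> simp [deg, b0] at h ⊢

lemma tw0_eq : tw0 = Finsupp.single b0 1 := rfl

lemma eq_smul_tw0 (x : V 0) : x = x b0 • tw0 := by
  ext b
  rw [eq_b0 b, tw0_eq]
  simp

lemma d_tw0 : d 0 tw0 = 0 := by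
  have h : dTarget 0 b0 = 0 := rfl
  rw [tw0_eq, d_single, h, smul_zero]

/-- The cohomology of `L`: `H⁰(L)` is 1-dimensional spanned by the
class of `ω̃₀` (in degree `0` classes are cocycles, as there are no coboundaries),
`H⁴(L)` is 1-dimensional spanned by the class of `ω₄`, and `Hⁿ(L) = 0` for all
`n ∉ {0, 4}` (in negative degrees the complex vanishes). -/
theorem statement8 :
    -- `H⁰(L)` is 1-dimensional, spanned by the class of `ω̃₀`
    (LinearMap.ker (d 0) = Submodule.span ℚ {tw0} ∧ tw0 ≠ 0) ∧
    -- `H⁴(L)` is 1-dimensional, spanned by the class of `ω₄`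
    (d 4 om4 = 0 ∧
      (∀ x : V 4, d 4 x = 0 → ∃ (c : ℚ) (y : V 3), x = c • om4 + d 3 y) ∧
      (∀ c : ℚ, (∃ y : V 3, c • om4 = d 3 y) → c = 0)) ∧
    -- `Hⁿ(L) = 0` for all `n ∉ {0, 4}`
    (∀ (n : ℕ), n + 1 ≠ 4 →
      ∀ x : V (n + 1), d (n + 1) x = 0 → ∃ y : V n, d n y = x) := by
  refine ⟨⟨?_, ?_⟩, ⟨?_, ?_, ?_⟩, ?_⟩
  · apply le_antisymm
    · intro x _
      exact Submodule.mem_span_singleton.2 ⟨x b0, (eq_smul_tw0 x).symm⟩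
    · rw [Submodule.span_singleton_le_iff_mem]
      exact d_tw0
  · rw [tw0_eq]
    simp
  · have h : dTarget 4 b4 = 0 := rfl
    rw [om4_eq, d_single, h, smul_zero]
  · intro x hx
    refine ⟨x b4, sMap 3 x, ?_⟩
    have h := homotopy_four x
    rw [hx, map_zero, add_zero] at h
    exact h.symm.trans (add_comm _ _)
  · rintro c ⟨y, hy⟩
    have h := d_three_apply y
    rw [← hy, om4_eq] at h
    simpa using h
  · intro n hn x hx
    refine ⟨sMap n x, ?_⟩
    have h := homotopy n hn x
    rwa [hx, map_zero, add_zero] at h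

end Stmt8
end
end

section
/- The cochain cohomology of T is as follows: H^n(T) = 0 for all odd n; H⁰(T) and H²(T) are 1-dimensional, spanned by the classes of ω̃₀ and ω₂ ω̃₀ respectively; and for every k ≥ 0 the group H^{2k+4}(T) is 2-dimensional, with basis given by the classes of ω₂^{k+2} ω̃₀ and of the cocycle ω₂^k ω₄ − ω₂^{k+1} ω̃₂. (These are the rational cohomology dimensions of the homotopy quotient S⁴⫽S¹, verifying the minimal DG-module model over ℚ[h₃] for the fiberwise suspension spectrum of S⁴⫽S¹ over S³.) -/
/-!
# Statement 9

The complex `T` (minimal DG-module model over `ℚ[h₃]` for the fiberwise suspension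
spectrum of the A-type orbispace `S⁴ ⫽ S¹` over `S³`) has vanishing odd cohomology,
`H⁰` and `H²` one-dimensional spanned by the classes of `ω̃₀` and `ω₂ ω̃₀`, and
`H^{2k+4}` two-dimensional with basis the classes of `ω₂^{k+2} ω̃₀` and
`ω₂^k ω₄ − ω₂^{k+1} ω̃₂`.

The complex is concentrated in non-negative degrees, so it is indexed by `ℕ`;
in degree `0` there are no coboundaries, so `H⁰` is the space of `0`-cocycles.
-/

noncomputable section

namespace Stmt9

/-- Index for the basis of `T`: `(knd, ε, j, p)`; `knd = true` encodes
`h₃^ε ω₂^j ω̃_{2p}` (degree `3ε + 2j + 2p`), and `knd = false` encodes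
`h₃^ε ω₂^j ω_{2p+4}` (degree `3ε + 2j + 2p + 4`). -/
abbrev Idx : Type := Bool × Bool × ℕ × ℕ

/-- Degree of a basis symbol. -/
def deg : Idx → ℕ :=
  fun q => 3 * q.2.1.toNat + 2 * q.2.2.1 + 2 * q.2.2.2 + 4 * (!q.1).toNat

/-- Basis of the degree-`n` component of `T`. -/
abbrev B (n : ℕ) : Type := {q : Idx // deg q = n}

/-- The degree-`n` component of the complex `T`. -/
abbrev V (n : ℕ) : Type := B n →₀ ℚ

/-- The differential on basis elements:
`d(ω₂^j ω̃₀) = 0`, `d(ω₂^j ω̃_{2p+2}) = h₃ ω₂^j ω̃_{2p}`,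
`d(ω₂^j ω₄) = h₃ ω₂^{j+1} ω̃₀`, `d(ω₂^j ω_{2p+6}) = h₃ ω₂^j ω_{2p+4}`,
`d(h₃ ⬝) = 0`. -/
def dTarget (n : ℕ) : B n → V (n + 1) := fun b =>
  match b with
  | ⟨(true, false, _, 0), _⟩ => 0
  | ⟨(true, false, j, p + 1), h⟩ =>
      Finsupp.single ⟨(true, true, j, p), by simp [deg] at h ⊢; omega⟩ 1
  | ⟨(false, false, j, 0), h⟩ =>
      Finsupp.single ⟨(true, true, j + 1, 0), by simp [deg] at h ⊢; omega⟩ 1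
  | ⟨(false, false, j, p + 1), h⟩ =>
      Finsupp.single ⟨(false, true, j, p), by simp [deg] at h ⊢; omega⟩ 1
  | ⟨(_, true, _, _), _⟩ => 0

/-- The differential of `T`. -/
def d (n : ℕ) : V n →ₗ[ℚ] V (n + 1) :=
  Finsupp.linearCombination ℚ (dTarget n)

/-- The basis element `ω̃₀` in degree `0`. -/
def tw0 : V 0 := Finsupp.single ⟨(true, false, 0, 0), by simp [deg]⟩ 1

/-- The basis element `ω₂ ω̃₀` in degree `2`. -/
def w2tw0 : V 2 := Finsupp.single ⟨(true, false, 1, 0), by simp [deg]⟩ 1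

/-- The basis element `ω₂^{k+2} ω̃₀` in degree `2k + 4`. -/
def aElt (k : ℕ) : V (2 * k + 4) :=
  Finsupp.single ⟨(true, false, k + 2, 0), by simp [deg]; try omega⟩ 1

/-- The cocycle `ω₂^k ω₄ − ω₂^{k+1} ω̃₂` in degree `2k + 4`. -/
def bElt (k : ℕ) : V (2 * k + 4) :=
  Finsupp.single ⟨(false, false, k, 0), by simp [deg]; try omega⟩ 1 -
    Finsupp.single ⟨(true, false, k + 1, 1), by simp [deg]; try omega⟩ 1

lemma d_single (n : ℕ) (b : B n) (c : ℚ) : d n (Finsupp.single b c) = c • dTarget n b := by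
  simp [d]

/-- Coefficient of `d x` at `h₃ ω₂^j ω_{2p+4}`. -/
lemma coeff_ff (n : ℕ) (x : V n) (j p : ℕ) (h : deg (false, false, j, p + 1) = n)
    (h' : deg (false, true, j, p) = n + 1) :
    d n x ⟨(false, true, j, p), h'⟩ = x ⟨(false, false, j, p + 1), h⟩ := by
  induction x using Finsupp.induction_linear with
  | zero => simp
  | add f g hf hg => simp [hf, hg]
  | single b c =>
    rw [d_single]
    rcases b with ⟨⟨_ | _, _ | _, j', _ | p'⟩, hb⟩ <;>
      simp [dTarget, Finsupp.single_apply]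

/-- Coefficient of `d x` at `h₃ ω₂^j ω̃_{2p+2}`. -/
lemma coeff_tp (n : ℕ) (x : V n) (j p : ℕ) (h : deg (true, false, j, p + 2) = n)
    (h' : deg (true, true, j, p + 1) = n + 1) :
    d n x ⟨(true, true, j, p + 1), h'⟩ = x ⟨(true, false, j, p + 2), h⟩ := by
  induction x using Finsupp.induction_linear with
  | zero => simp
  | add f g hf hg => simp [hf, hg]
  | single b c =>
    rw [d_single]
    rcases b with ⟨⟨_ | _, _ | _, j', _ | p'⟩, hb⟩ <;>
      simp [dTarget, Finsupp.single_apply]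

/-- Coefficient of `d x` at `h₃ ω̃₀`. -/
lemma coeff_t0 (n : ℕ) (x : V n) (h : deg (true, false, 0, 1) = n)
    (h' : deg (true, true, 0, 0) = n + 1) :
    d n x ⟨(true, true, 0, 0), h'⟩ = x ⟨(true, false, 0, 1), h⟩ := by
  induction x using Finsupp.induction_linear with
  | zero => simp
  | add f g hf hg => simp [hf, hg]
  | single b c =>
    rw [d_single]
    rcases b with ⟨⟨_ | _, _ | _, j', _ | p'⟩, hb⟩ <;>
      simp [dTarget, Finsupp.single_apply]

/-- Coefficient of `d x` at `h₃ ω₂^{j+1} ω̃₀`. -/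
lemma coeff_ts (n : ℕ) (x : V n) (j : ℕ) (h : deg (true, false, j + 1, 1) = n)
    (h2 : deg (false, false, j, 0) = n)
    (h' : deg (true, true, j + 1, 0) = n + 1) :
    d n x ⟨(true, true, j + 1, 0), h'⟩ =
      x ⟨(true, false, j + 1, 1), h⟩ + x ⟨(false, false, j, 0), h2⟩ := by
  induction x using Finsupp.induction_linear with
  | zero => simp
  | add f g hf hg => simp [hf, hg]; ring
  | single b c =>
    rw [d_single]
    rcases b with ⟨⟨_ | _, _ | _, j', _ | p'⟩, hb⟩ <;>
      simp [dTarget, Finsupp.single_apply]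

/-- The differential vanishes on odd degrees. -/
lemma d_odd (n : ℕ) (hn : Odd n) (y : V n) : d n y = 0 := by
  induction y using Finsupp.induction_linear with
  | zero => simp
  | add f g hf hg => simp [hf, hg]
  | single b c =>
    rw [d_single]
    obtain ⟨m, hm⟩ := hn
    rcases b with ⟨⟨_ | _, _ | _, j', _ | p'⟩, hb⟩ <;>
      simp [deg] at hb <;> first | omega | simp [dTarget]

/-- The differential is onto odd degrees. -/
lemma d_surj (n : ℕ) (hn : Odd (n + 1)) (x : V (n + 1)) : ∃ y : V n, d n y = x := by
  induction x using Finsupp.induction_linear with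
  | zero => exact ⟨0, by simp⟩
  | add f g hf hg =>
    obtain ⟨a, rfl⟩ := hf
    obtain ⟨b, rfl⟩ := hg
    exact ⟨a + b, by simp⟩
  | single b c =>
    obtain ⟨m, hm⟩ := hn
    rcases b with ⟨⟨_ | _, _ | _, j, p⟩, hb⟩
    · simp [deg] at hb; omega
    · refine ⟨Finsupp.single ⟨(false, false, j, p + 1), by simp [deg] at hb ⊢; omega⟩ c, ?_⟩
      rw [d_single]
      simp [dTarget]
    · simp [deg] at hb; omega
    · refine ⟨Finsupp.single ⟨(true, false, j, p + 1), by simp [deg] at hb ⊢; omega⟩ c, ?_⟩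
      rw [d_single]
      simp [dTarget]

/-- The cohomology of `T`: `Hⁿ(T) = 0` for all odd `n`;
`H⁰(T)` and `H²(T)` are 1-dimensional spanned by the classes of `ω̃₀` and `ω₂ ω̃₀`
respectively; and for every `k ≥ 0`, `H^{2k+4}(T)` is 2-dimensional with basis the
classes of `ω₂^{k+2} ω̃₀` and of the cocycle `ω₂^k ω₄ − ω₂^{k+1} ω̃₂`. -/
theorem statement9 :
    -- odd cohomology vanishes
    (∀ n : ℕ, Odd (n + 1) →
      ∀ x : V (n + 1), d (n + 1) x = 0 → ∃ y : V n, d n y = x) ∧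
    -- `H⁰(T)` is 1-dimensional, spanned by the class of `ω̃₀`
    (LinearMap.ker (d 0) = Submodule.span ℚ {tw0} ∧ tw0 ≠ 0) ∧
    -- `H²(T)` is 1-dimensional, spanned by the class of `ω₂ ω̃₀`
    (d 2 w2tw0 = 0 ∧
      (∀ x : V 2, d 2 x = 0 → ∃ (c : ℚ) (y : V 1), x = c • w2tw0 + d 1 y) ∧
      (∀ c : ℚ, (∃ y : V 1, c • w2tw0 = d 1 y) → c = 0)) ∧
    -- `H^{2k+4}(T)` is 2-dimensional with basis `[ω₂^{k+2} ω̃₀]`, `[ω₂^k ω₄ − ω₂^{k+1} ω̃₂]`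
    (∀ k : ℕ,
      d (2 * k + 4) (aElt k) = 0 ∧ d (2 * k + 4) (bElt k) = 0 ∧
      (∀ x : V (2 * k + 4), d (2 * k + 4) x = 0 →
        ∃ (c₁ c₂ : ℚ) (y : V (2 * k + 3)),
          x = c₁ • aElt k + c₂ • bElt k + d (2 * k + 3) y) ∧
      (∀ c₁ c₂ : ℚ,
        (∃ y : V (2 * k + 3), c₁ • aElt k + c₂ • bElt k = d (2 * k + 3) y) →
        c₁ = 0 ∧ c₂ = 0)) := by
  refine ⟨fun n hn x _ => d_surj n hn x, ⟨?_, by simp [tw0]⟩, ⟨?_, ?_, ?_⟩, fun k => ⟨?_, ?_, ?_, ?_⟩⟩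
  · ext x
    rw [Submodule.mem_span_singleton, LinearMap.mem_ker]
    constructor
    · intro _
      refine ⟨x ⟨(true, false, 0, 0), by simp [deg]⟩, ?_⟩
      ext ⟨⟨_ | _, _ | _, j, p⟩, hb⟩ <;> have hb' := hb <;> simp [deg] at hb'
      obtain ⟨rfl, rfl⟩ := hb'
      simp [tw0]
    · rintro ⟨c, rfl⟩
      simp [tw0, d_single, dTarget]
  · simp [w2tw0, d_single, dTarget]
  · intro x hx
    refine ⟨x ⟨(true, false, 1, 0), by simp [deg]⟩, 0, ?_⟩
    have h0 := coeff_t0 2 x (by simp [deg]) (by simp [deg])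
    rw [hx] at h0
    ext ⟨⟨_ | _, _ | _, j, p⟩, hb⟩ <;> have hb' := hb <;> simp [deg] at hb' <;> try omega
    have : (j = 0 ∧ p = 1) ∨ (j = 1 ∧ p = 0) := by omega
    rcases this with ⟨rfl, rfl⟩ | ⟨rfl, rfl⟩
    · simpa [w2tw0, Finsupp.single_apply] using h0.symm
    · simp [w2tw0]
  · rintro c ⟨y, hy⟩
    rw [d_odd 1 (by decide)] at hy
    simpa [w2tw0] using hy
  · simp [aElt, d_single, dTarget]
  · simp [bElt, d_single, dTarget]
  · intro x hx
    refine ⟨x ⟨(true, false, k + 2, 0), by simp [deg]; try omega⟩,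
      x ⟨(false, false, k, 0), by simp [deg]; try omega⟩, 0, ?_⟩
    ext ⟨⟨_ | _, _ | _, j, p⟩, hb⟩ <;> have hb' := hb <;> simp [deg] at hb' <;> try omega
    · rcases p with _ | p
      · obtain rfl : j = k := by omega
        simp [aElt, bElt, Finsupp.single_apply]
      · have h0 := coeff_ff _ x j p hb (by simp [deg]; omega)
        rw [hx] at h0
        simpa [aElt, bElt, Finsupp.single_apply] using h0.symm
    · rcases p with _ | _ | p
      · obtain rfl : j = k + 2 := by omega
        simp [aElt, bElt, Finsupp.single_apply]
      · obtain rfl : j = k + 1 := by omega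
        have h0 := coeff_ts _ x k hb (by simp [deg]; try omega) (by simp [deg]; omega)
        rw [hx] at h0
        simp [aElt, bElt, Finsupp.single_apply] at h0 ⊢
        linarith
      · have h0 := coeff_tp _ x j p hb (by simp [deg]; omega)
        rw [hx] at h0
        simpa [aElt, bElt, Finsupp.single_apply] using h0.symm
  · rintro c₁ c₂ ⟨y, hy⟩
    rw [d_odd _ ⟨k + 1, by ring⟩] at hy
    have h1 := DFunLike.congr_fun hy ⟨(true, false, k + 2, 0), by simp [deg]; try omega⟩
    have h2 := DFunLike.congr_fun hy ⟨(false, false, k, 0), by simp [deg]; try omega⟩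
    simp [aElt, bElt, Finsupp.single_apply] at h1 h2
    exact ⟨h1, h2⟩

end Stmt9
end
end

section
/- The ℚ-linear map Θ : T → A determined on basis elements by Θ(ω₂^j ω̃₀) = ω₂^j, Θ(ω₂^j ω₄) = ω₂^j ω₄, and Θ(x) = 0 for every other basis element x of T (i.e., whenever ε = 1, or the symbol involves some ω̃_{2p+2}, or some ω_{2p+6}) is a cochain map (Θ ∘ d = d ∘ Θ) and a quasi-isomorphism: it induces an isomorphism H^n(T) → H^n(A) for every integer n. -/
/-!
# Statement 10

The ℚ-linear map `Θ : T → A`, sending `ω₂^j ω̃₀ ↦ ω₂^j`, `ω₂^j ω₄ ↦ ω₂^j ω₄` and all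
other basis elements to `0`, is a cochain map and a quasi-isomorphism.

Both complexes are concentrated in non-negative degrees, so they are indexed by `ℕ`,
and the maps are given degreewise.  "Quasi-isomorphism" is rendered by the (equivalent)
elementary conditions that the induced map on cohomology classes is surjective and
injective in every degree; in degree `0` there are no coboundaries.
-/

noncomputable section

namespace Stmt10

/-! ## The complex `T` -/

/-- Index for the basis of `T`: `(knd, ε, j, p)`; `knd = true` encodes
`h₃^ε ω₂^j ω̃_{2p}`, and `knd = false` encodes `h₃^ε ω₂^j ω_{2p+4}`. -/
abbrev TIdx : Type := Bool × Bool × ℕ × ℕ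

/-- Degree of a basis symbol of `T`. -/
def Tdeg : TIdx → ℕ :=
  fun q => 3 * q.2.1.toNat + 2 * q.2.2.1 + 2 * q.2.2.2 + 4 * (!q.1).toNat

/-- Basis of the degree-`n` component of `T`. -/
abbrev TB (n : ℕ) : Type := {q : TIdx // Tdeg q = n}

/-- The degree-`n` component of the complex `T`. -/
abbrev TV (n : ℕ) : Type := TB n →₀ ℚ

/-- The differential of `T` on basis elements. -/
def TdTarget (n : ℕ) : TB n → TV (n + 1) := fun b =>
  match b with
  | ⟨(true, false, _, 0), _⟩ => 0
  | ⟨(true, false, j, p + 1), h⟩ =>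
      Finsupp.single ⟨(true, true, j, p), by simp [Tdeg] at h ⊢; omega⟩ 1
  | ⟨(false, false, j, 0), h⟩ =>
      Finsupp.single ⟨(true, true, j + 1, 0), by simp [Tdeg] at h ⊢; omega⟩ 1
  | ⟨(false, false, j, p + 1), h⟩ =>
      Finsupp.single ⟨(false, true, j, p), by simp [Tdeg] at h ⊢; omega⟩ 1
  | ⟨(_, true, _, _), _⟩ => 0

/-- The differential of `T`. -/
def Td (n : ℕ) : TV n →ₗ[ℚ] TV (n + 1) :=
  Finsupp.linearCombination ℚ (TdTarget n)

/-! ## The complex `A` -/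

/-- Index for the basis of `A`: `(β, i, j)`; `β = false` encodes `ω₂^i ω₄^j`
(degree `2i + 4j`), and `β = true` encodes `ω₂^i ω₄^j h₇` (degree `2i + 4j + 7`). -/
abbrev AIdx : Type := Bool × ℕ × ℕ

/-- Degree of a basis symbol of `A`. -/
def Adeg : AIdx → ℕ := fun q => 2 * q.2.1 + 4 * q.2.2 + 7 * q.1.toNat

/-- Basis of the degree-`n` component of `A`. -/
abbrev AB (n : ℕ) : Type := {q : AIdx // Adeg q = n}

/-- The degree-`n` component of the complex `A`. -/
abbrev AV (n : ℕ) : Type := AB n →₀ ℚ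

/-- The differential of `A` on basis elements:
`d(ω₂^i ω₄^j) = 0` and `d(ω₂^i ω₄^j h₇) = −(1/2) ω₂^i ω₄^{j+2}`. -/
def AdTarget (n : ℕ) : AB n → AV (n + 1) := fun b =>
  match b with
  | ⟨(false, _, _), _⟩ => 0
  | ⟨(true, i, j), h⟩ =>
      Finsupp.single ⟨(false, i, j + 2), by simp [Adeg] at h ⊢; omega⟩ (-(1 / 2) : ℚ)

/-- The differential of `A`. -/
def Ad (n : ℕ) : AV n →ₗ[ℚ] AV (n + 1) :=
  Finsupp.linearCombination ℚ (AdTarget n)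

/-! ## The comparison map `Θ` -/

/-- `Θ` on basis elements: `Θ(ω₂^j ω̃₀) = ω₂^j`, `Θ(ω₂^j ω₄) = ω₂^j ω₄`,
and `Θ = 0` on every other basis element. -/
def ThetaTarget (n : ℕ) : TB n → AV n := fun b =>
  match b with
  | ⟨(true, false, j, 0), h⟩ =>
      Finsupp.single ⟨(false, j, 0), by simp [Tdeg, Adeg] at h ⊢; omega⟩ 1
  | ⟨(false, false, j, 0), h⟩ =>
      Finsupp.single ⟨(false, j, 1), by simp [Tdeg, Adeg] at h ⊢; omega⟩ 1
  | _ => 0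

/-- The ℚ-linear map `Θ : T → A` (degreewise). -/
def Theta (n : ℕ) : TV n →ₗ[ℚ] AV n :=
  Finsupp.linearCombination ℚ (ThetaTarget n)

/-- Homotopy inverse of `Θ` on basis elements. -/
def PsiTarget (n : ℕ) : AB n → TV n := fun b =>
  match b with
  | ⟨(false, i, 0), h⟩ =>
      Finsupp.single ⟨(true, false, i, 0), by simp [Tdeg, Adeg] at h ⊢; omega⟩ 1
  | ⟨(false, i, 1), h⟩ =>
      Finsupp.single ⟨(false, false, i, 0), by simp [Tdeg, Adeg] at h ⊢; omega⟩ 1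
      - Finsupp.single ⟨(true, false, i + 1, 1), by simp [Tdeg, Adeg] at h ⊢; omega⟩ 1
  | _ => 0

/-- Homotopy inverse of `Θ`. -/
def Psi (n : ℕ) : AV n →ₗ[ℚ] TV n :=
  Finsupp.linearCombination ℚ (PsiTarget n)

/-- Contracting homotopy on `T`, on basis elements. -/
def HTarget (n : ℕ) : TB (n + 1) → TV n := fun b =>
  match b with
  | ⟨(k, true, j, p), h⟩ =>
      Finsupp.single ⟨(k, false, j, p + 1), by simp [Tdeg] at h ⊢; omega⟩ 1
  | _ => 0

/-- Contracting homotopy on `T`. -/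
def Hh (n : ℕ) : TV (n + 1) →ₗ[ℚ] TV n :=
  Finsupp.linearCombination ℚ (HTarget n)

/-- Contracting homotopy on `A`, on basis elements. -/
def KTarget (n : ℕ) : AB (n + 1) → AV n := fun b =>
  match b with
  | ⟨(false, i, j + 2), h⟩ =>
      Finsupp.single ⟨(true, i, j), by simp [Adeg] at h ⊢; omega⟩ (-2)
  | _ => 0

/-- Contracting homotopy on `A`. -/
def Kh (n : ℕ) : AV (n + 1) →ₗ[ℚ] AV n :=
  Finsupp.linearCombination ℚ (KTarget n)

theorem ext_T {n : ℕ} {M : Type*} [AddCommGroup M] [Module ℚ M] (f g : TV n →ₗ[ℚ] M)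
    (h : ∀ b : TB n, f (Finsupp.single b 1) = g (Finsupp.single b 1)) (x : TV n) :
    f x = g x := by
  have : f = g := Finsupp.lhom_ext' fun b => LinearMap.ext_ring (h b)
  rw [this]

theorem ext_A {n : ℕ} {M : Type*} [AddCommGroup M] [Module ℚ M] (f g : AV n →ₗ[ℚ] M)
    (h : ∀ b : AB n, f (Finsupp.single b 1) = g (Finsupp.single b 1)) (x : AV n) :
    f x = g x := by
  have : f = g := Finsupp.lhom_ext' fun b => LinearMap.ext_ring (h b)
  rw [this]

theorem theta_comm (n : ℕ) (x : TV n) : Theta (n + 1) (Td n x) = Ad n (Theta n x) := by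
  refine ext_T (Theta (n + 1) ∘ₗ Td n) (Ad n ∘ₗ Theta n) ?_ x
  rintro ⟨⟨_ | _, _ | _, j, _ | p⟩, h⟩ <;>
    simp [Theta, Td, Ad, TdTarget, ThetaTarget, AdTarget]

theorem td_psi (n : ℕ) (y : AV n) : Td n (Psi n y) = 0 := by
  refine ext_A (Td n ∘ₗ Psi n) 0 ?_ y
  rintro ⟨⟨_ | _, i, _ | _ | j⟩, h⟩ <;> simp [Psi, Td, TdTarget, PsiTarget]

theorem psi_ad (n : ℕ) (y : AV n) : Psi (n + 1) (Ad n y) = 0 := by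
  refine ext_A (Psi (n + 1) ∘ₗ Ad n) 0 ?_ y
  rintro ⟨⟨_ | _, i, _ | _ | j⟩, h⟩ <;> simp [Psi, Ad, AdTarget, PsiTarget]

theorem homotopy_T_zero (x : TV 0) : x = Psi 0 (Theta 0 x) + Hh 0 (Td 0 x) := by
  refine ext_T LinearMap.id (Psi 0 ∘ₗ Theta 0 + Hh 0 ∘ₗ Td 0) ?_ x
  rintro ⟨⟨_ | _, _ | _, j, _ | p⟩, h⟩ <;>
    first
    | (exfalso; simp [Tdeg] at h; done)
    | simp [Psi, Theta, Td, Hh, TdTarget, ThetaTarget, PsiTarget, HTarget]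

theorem homotopy_T_succ (n : ℕ) (x : TV (n + 1)) :
    x = Psi (n + 1) (Theta (n + 1) x) + Hh (n + 1) (Td (n + 1) x) + Td n (Hh n x) := by
  refine ext_T LinearMap.id
    (Psi (n + 1) ∘ₗ Theta (n + 1) + Hh (n + 1) ∘ₗ Td (n + 1) + Td n ∘ₗ Hh n) ?_ x
  rintro ⟨⟨_ | _, _ | _, j, _ | p⟩, h⟩ <;>
    simp [Psi, Theta, Td, Hh, TdTarget, ThetaTarget, PsiTarget, HTarget]

theorem homotopy_A_zero (y : AV 0) : y = Theta 0 (Psi 0 y) + Kh 0 (Ad 0 y) := by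
  refine ext_A LinearMap.id (Theta 0 ∘ₗ Psi 0 + Kh 0 ∘ₗ Ad 0) ?_ y
  rintro ⟨⟨_ | _, i, _ | _ | j⟩, h⟩ <;>
    first
    | (exfalso; simp [Adeg] at h; done)
    | simp [Psi, Theta, Ad, Kh, AdTarget, ThetaTarget, PsiTarget, KTarget]

theorem homotopy_A_succ (n : ℕ) (y : AV (n + 1)) :
    y = Theta (n + 1) (Psi (n + 1) y) + Kh (n + 1) (Ad (n + 1) y) + Ad n (Kh n y) := by
  refine ext_A LinearMap.id
    (Theta (n + 1) ∘ₗ Psi (n + 1) + Kh (n + 1) ∘ₗ Ad (n + 1) + Ad n ∘ₗ Kh n) ?_ y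
  rintro ⟨⟨_ | _, i, _ | _ | j⟩, h⟩ <;>
    simp [Psi, Theta, Ad, Kh, AdTarget, ThetaTarget, PsiTarget, KTarget]

/-- `Θ : T → A` is a cochain map and a quasi-isomorphism: it induces
an isomorphism `Hⁿ(T) → Hⁿ(A)` for every `n` (surjectivity and injectivity on
cohomology classes in each degree; in negative degrees both complexes vanish). -/
theorem statement10 :
    -- `Θ` is a cochain map
    (∀ (n : ℕ) (x : TV n), Theta (n + 1) (Td n x) = Ad n (Theta n x)) ∧
    -- surjectivity on `H⁰`
    (∀ y : AV 0, Ad 0 y = 0 → ∃ x : TV 0, Td 0 x = 0 ∧ Theta 0 x = y) ∧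
    -- injectivity on `H⁰`
    (∀ x : TV 0, Td 0 x = 0 → Theta 0 x = 0 → x = 0) ∧
    -- surjectivity on `H^{n+1}`
    (∀ (n : ℕ) (y : AV (n + 1)), Ad (n + 1) y = 0 →
      ∃ x : TV (n + 1), Td (n + 1) x = 0 ∧ ∃ s : AV n, Theta (n + 1) x = y + Ad n s) ∧
    -- injectivity on `H^{n+1}`
    (∀ (n : ℕ) (x : TV (n + 1)), Td (n + 1) x = 0 →
      (∃ s : AV n, Theta (n + 1) x = Ad n s) → ∃ t : TV n, x = Td n t) := by
  refine ⟨theta_comm, ?_, ?_, ?_, ?_⟩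
  · intro y hy
    refine ⟨Psi 0 y, td_psi 0 y, ?_⟩
    have h := homotopy_A_zero y
    rw [hy, map_zero, add_zero] at h
    exact h.symm
  · intro x hx hx'
    have h := homotopy_T_zero x
    rw [hx, hx', map_zero, map_zero, add_zero] at h
    exact h
  · intro n y hy
    refine ⟨Psi (n + 1) y, td_psi (n + 1) y, -Kh n y, ?_⟩
    have h := homotopy_A_succ n y
    rw [hy, map_zero, add_zero] at h
    rw [map_neg, ← sub_eq_add_neg]
    exact eq_sub_of_add_eq h.symm
  · rintro n x hx ⟨s, hs⟩
    refine ⟨Hh n x, ?_⟩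
    have h := homotopy_T_succ n x
    rw [hx, hs, psi_ad, map_zero, zero_add, zero_add] at h
    exact h

end Stmt10
end
end

section
/- Define rational sequences a₁ = b₁ = 1 and, for n ≥ 2, b_n = (2n−1) · a_{n−1} and a_n = n · b_n. Then the ℚ-linear map φ : S → T determined on basis elements by φ(h₃^ε ω₂^j) = h₃^ε ω₂^j ω̃₀, φ(h₃^ε ω₂^j ω₄) = h₃^ε ω₂^j ω₄, φ(h₃^ε ω₂^j ω₆^n) = a_n · h₃^ε ω₂^{j+n−1} ω_{4n+2} for n ≥ 1, and φ(h₃^ε ω₂^j ω₆^n ω₄) = b_{n+1} · h₃^ε ω₂^{j+n} ω_{4n+4} for n ≥ 1, is a cochain map (φ ∘ d = d ∘ φ) and is injective. (This map models the fiberwise stabilization of the Ext/Cyc-adjunction unit at the A-type orbispace of the 4-sphere.) -/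
/-!
# Statement 12

With rational sequences `a₁ = b₁ = 1`, `b_n = (2n−1)·a_{n−1}` and `a_n = n·b_n`
(`n ≥ 2`), the ℚ-linear map `φ : S → T` determined on basis elements by
`φ(h₃^ε ω₂^j) = h₃^ε ω₂^j ω̃₀`, `φ(h₃^ε ω₂^j ω₄) = h₃^ε ω₂^j ω₄`,
`φ(h₃^ε ω₂^j ω₆^n) = a_n · h₃^ε ω₂^{j+n−1} ω_{4n+2}` (`n ≥ 1`) and
`φ(h₃^ε ω₂^j ω₆^n ω₄) = b_{n+1} · h₃^ε ω₂^{j+n} ω_{4n+4}` (`n ≥ 1`)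
is a cochain map and is injective.

Both complexes are concentrated in non-negative degrees, so they are indexed by `ℕ`,
and the map is given degreewise.
-/

noncomputable section

namespace Stmt12

/-! ## The complex `S` -/

/-- Index for the basis of `S`: `(knd, ε, j, m)`; `knd = false` encodes
`h₃^ε ω₂^j ω₆^m`, and `knd = true` encodes `h₃^ε ω₂^j ω₆^m ω₄`. -/
abbrev SIdx : Type := Bool × Bool × ℕ × ℕ

/-- Degree of a basis symbol of `S`. -/
def Sdeg : SIdx → ℕ :=
  fun q => 3 * q.2.1.toNat + 2 * q.2.2.1 + 6 * q.2.2.2 + 4 * q.1.toNat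

/-- Basis of the degree-`n` component of `S`. -/
abbrev SB (n : ℕ) : Type := {q : SIdx // Sdeg q = n}

/-- The degree-`n` component of `S`. -/
abbrev SV (n : ℕ) : Type := SB n →₀ ℚ

/-- The differential of `S` on basis elements. -/
def SdTarget (n : ℕ) : SB n → SV (n + 1) := fun b =>
  match b with
  | ⟨(false, false, _, 0), _⟩ => 0
  | ⟨(false, false, j, m + 1), h⟩ =>
      ((m : ℚ) + 1) •
        Finsupp.single ⟨(true, true, j, m), by simp [Sdeg] at h ⊢; omega⟩ 1
  | ⟨(true, false, j, m), h⟩ =>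
      (2 * (m : ℚ) + 1) •
        Finsupp.single ⟨(false, true, j + 1, m), by simp [Sdeg] at h ⊢; omega⟩ 1
  | ⟨(_, true, _, _), _⟩ => 0

/-- The differential of `S`. -/
def Sd (n : ℕ) : SV n →ₗ[ℚ] SV (n + 1) :=
  Finsupp.linearCombination ℚ (SdTarget n)

/-! ## The complex `T` -/

/-- Index for the basis of `T`: `(knd, ε, j, p)`; `knd = true` encodes
`h₃^ε ω₂^j ω̃_{2p}`, and `knd = false` encodes `h₃^ε ω₂^j ω_{2p+4}`. -/
abbrev TIdx : Type := Bool × Bool × ℕ × ℕ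

/-- Degree of a basis symbol of `T`. -/
def Tdeg : TIdx → ℕ :=
  fun q => 3 * q.2.1.toNat + 2 * q.2.2.1 + 2 * q.2.2.2 + 4 * (!q.1).toNat

/-- Basis of the degree-`n` component of `T`. -/
abbrev TB (n : ℕ) : Type := {q : TIdx // Tdeg q = n}

/-- The degree-`n` component of `T`. -/
abbrev TV (n : ℕ) : Type := TB n →₀ ℚ

/-- The differential of `T` on basis elements. -/
def TdTarget (n : ℕ) : TB n → TV (n + 1) := fun b =>
  match b with
  | ⟨(true, false, _, 0), _⟩ => 0
  | ⟨(true, false, j, p + 1), h⟩ =>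
      Finsupp.single ⟨(true, true, j, p), by simp [Tdeg] at h ⊢; omega⟩ 1
  | ⟨(false, false, j, 0), h⟩ =>
      Finsupp.single ⟨(true, true, j + 1, 0), by simp [Tdeg] at h ⊢; omega⟩ 1
  | ⟨(false, false, j, p + 1), h⟩ =>
      Finsupp.single ⟨(false, true, j, p), by simp [Tdeg] at h ⊢; omega⟩ 1
  | ⟨(_, true, _, _), _⟩ => 0

/-- The differential of `T`. -/
def Td (n : ℕ) : TV n →ₗ[ℚ] TV (n + 1) :=
  Finsupp.linearCombination ℚ (TdTarget n)

/-! ## The map `φ` -/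

/-- `φ` on basis elements (for coefficient sequences `a`, `b`):
`φ(h₃^ε ω₂^j) = h₃^ε ω₂^j ω̃₀`, `φ(h₃^ε ω₂^j ω₄) = h₃^ε ω₂^j ω₄`,
`φ(h₃^ε ω₂^j ω₆^n) = a_n · h₃^ε ω₂^{j+n−1} ω_{4n+2}` for `n ≥ 1`, and
`φ(h₃^ε ω₂^j ω₆^n ω₄) = b_{n+1} · h₃^ε ω₂^{j+n} ω_{4n+4}` for `n ≥ 1`;
here `ω_{4n+2} = ω_{2(2n−1)+4}` and `ω_{4n+4} = ω_{2(2n)+4}`. -/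
def phiTarget (a b : ℕ → ℚ) (n : ℕ) : SB n → TV n := fun q =>
  match q with
  | ⟨(false, ε, j, 0), h⟩ =>
      Finsupp.single ⟨(true, ε, j, 0), by simp [Sdeg, Tdeg] at h ⊢; omega⟩ 1
  | ⟨(false, ε, j, m + 1), h⟩ =>
      a (m + 1) •
        Finsupp.single ⟨(false, ε, j + m, 2 * m + 1), by
          simp [Sdeg, Tdeg] at h ⊢; omega⟩ 1
  | ⟨(true, ε, j, 0), h⟩ =>
      Finsupp.single ⟨(false, ε, j, 0), by simp [Sdeg, Tdeg] at h ⊢; omega⟩ 1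
  | ⟨(true, ε, j, m + 1), h⟩ =>
      b (m + 2) •
        Finsupp.single ⟨(false, ε, j + m + 1, 2 * m + 2), by
          simp [Sdeg, Tdeg] at h ⊢; omega⟩ 1

/-- The ℚ-linear map `φ : S → T` (degreewise). -/
def phi (a b : ℕ → ℚ) (n : ℕ) : SV n →ₗ[ℚ] TV n :=
  Finsupp.linearCombination ℚ (phiTarget a b n)

/-- The index of the basis element hit by `φ`. -/
def phiIdx : SIdx → TIdx
  | (false, ε, j, 0) => (true, ε, j, 0)
  | (false, ε, j, m + 1) => (false, ε, j + m, 2 * m + 1)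
  | (true, ε, j, 0) => (false, ε, j, 0)
  | (true, ε, j, m + 1) => (false, ε, j + m + 1, 2 * m + 2)

lemma phiIdx_inj : Function.Injective phiIdx := by
  rintro ⟨k, e, j, m⟩ ⟨k', e', j', m'⟩ h
  rcases k <;> rcases k' <;> rcases m with _ | m <;> rcases m' with _ | m' <;>
    simp [phiIdx] at h ⊢ <;> grind

lemma phiIdx_deg (q : SIdx) : Tdeg (phiIdx q) = Sdeg q := by
  obtain ⟨k, e, j, m⟩ := q
  rcases k <;> rcases m with _ | m <;> simp [phiIdx, Sdeg, Tdeg] <;> omega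

/-- The coefficient appearing in `φ`. -/
def phiCoef (a b : ℕ → ℚ) : SIdx → ℚ
  | (false, _, _, 0) => 1
  | (false, _, _, m + 1) => a (m + 1)
  | (true, _, _, 0) => 1
  | (true, _, _, m + 1) => b (m + 2)

lemma phiTarget_eq (a b : ℕ → ℚ) (n : ℕ) (q : SB n) :
    phiTarget a b n q =
      Finsupp.single (⟨phiIdx q.1, (phiIdx_deg q.1).trans q.2⟩ : TB n) (phiCoef a b q.1) := by
  obtain ⟨⟨k, e, j, m⟩, h⟩ := q
  rcases k <;> rcases m with _ | m <;> simp [phiTarget, phiIdx, phiCoef]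

lemma phi_apply_idx (a b : ℕ → ℚ) (n : ℕ) (x : SV n) (q : SB n) :
    phi a b n x ⟨phiIdx q.1, (phiIdx_deg q.1).trans q.2⟩ = x q * phiCoef a b q.1 := by
  induction x using Finsupp.induction_linear with
  | zero => simp
  | add f g hf hg => simp [hf, hg, add_mul]
  | single r c =>
    simp only [phi, Finsupp.linearCombination_single, phiTarget_eq, Finsupp.smul_apply,
      smul_eq_mul]
    by_cases hr : r = q
    · subst hr; simp
    · rw [Finsupp.single_eq_of_ne, Finsupp.single_eq_of_ne]
      · simp
      · exact fun h => hr h.symm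
      · intro h
        exact hr (Subtype.ext (phiIdx_inj (Subtype.mk.inj h).symm))

/-- For sequences with `a₁ = b₁ = 1`, `b_n = (2n−1)·a_{n−1}` and
`a_n = n·b_n` for `n ≥ 2`, the map `φ : S → T` is a cochain map and is injective.
(This map models the fiberwise stabilization of the `Ext/Cyc`-adjunction unit at the
A-type orbispace of the 4-sphere.) -/
theorem statement12 (a b : ℕ → ℚ) (ha1 : a 1 = 1) (hb1 : b 1 = 1)
    (hb : ∀ n : ℕ, 2 ≤ n → b n = (2 * (n : ℚ) - 1) * a (n - 1))
    (ha : ∀ n : ℕ, 2 ≤ n → a n = (n : ℚ) * b n) :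
    (∀ (n : ℕ) (x : SV n), phi a b (n + 1) (Sd n x) = Td n (phi a b n x)) ∧
    (∀ n : ℕ, Function.Injective (phi a b n)) := by
  have hab : ∀ m : ℕ, a (m + 1) = ((m : ℚ) + 1) * b (m + 1) := by
    intro m
    rcases m with _ | m
    · simp [ha1, hb1]
    · rw [ha (m + 1 + 1) (by omega)]; push_cast; ring
  have hba : ∀ m : ℕ, b (m + 2) = (2 * ((m : ℚ) + 1) + 1) * a (m + 1) := by
    intro m
    rw [hb (m + 2) (by omega)]
    simp only [show m + 2 - 1 = m + 1 by omega]
    push_cast; ring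
  have hb0 : ∀ m : ℕ, b (m + 1) ≠ 0 := by
    intro m
    induction m with
    | zero => simp [hb1]
    | succ m ih =>
      rw [hba, hab]
      have h1 : (m : ℚ) + 1 ≠ 0 := by positivity
      have h2 : 2 * ((m : ℚ) + 1) + 1 ≠ 0 := by positivity
      exact mul_ne_zero h2 (mul_ne_zero h1 ih)
  have ha0 : ∀ m : ℕ, a (m + 1) ≠ 0 := by
    intro m
    rw [hab]
    exact mul_ne_zero (by positivity) (hb0 m)
  refine ⟨?_, ?_⟩
  · intro n x
    induction x using Finsupp.induction_linear with
    | zero => simp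
    | add f g hf hg => simp only [map_add, hf, hg]
    | single q c =>
      simp only [phi, Sd, Finsupp.linearCombination_single, map_smul]
      congr 1
      obtain ⟨⟨k, e, j, m⟩, h⟩ := q
      rcases k <;> rcases e <;> rcases m with _ | m
      · simp [SdTarget, phiTarget, Td, TdTarget]
      · rcases m with _ | m
        · simp [SdTarget, phiTarget, Td, TdTarget, ha1]
        · have := hab (m + 1)
          push_cast at this
          simp only [SdTarget, phiTarget, Td, TdTarget, this, map_smul,
            Finsupp.linearCombination_single, one_smul, smul_smul]
          push_cast
          rw [one_mul]
          rfl
      · simp [SdTarget, phiTarget, Td, TdTarget]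
      · simp [SdTarget, phiTarget, Td, TdTarget]
      · simp [SdTarget, phiTarget, Td, TdTarget]
      · simp only [SdTarget, phiTarget, Td, TdTarget, hba, map_smul,
          Finsupp.linearCombination_single, one_smul, smul_smul]
        push_cast
        rw [one_mul]
        have hj : j + 1 + m = j + m + 1 := by omega
        simp only [hj]
      · simp [SdTarget, phiTarget, Td, TdTarget]
      · simp [SdTarget, phiTarget, Td, TdTarget]
  · intro n x y hxy
    ext q
    have h := phi_apply_idx a b n x q
    rw [hxy, phi_apply_idx] at h
    refine (mul_right_cancel₀ ?_ h).symm
    obtain ⟨⟨k, e, j, m⟩, _⟩ := q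
    rcases k <;> rcases m with _ | m <;> simp [phiCoef, ha0, hb0 (_ + 1)]


end Stmt12
end
end

section
/- With φ : S → T the injective cochain map of the fiberwise stabilized adjunction unit (defined by φ(h₃^ε ω₂^j) = h₃^ε ω₂^j ω̃₀, φ(h₃^ε ω₂^j ω₄) = h₃^ε ω₂^j ω₄, φ(h₃^ε ω₂^j ω₆^n) = a_n · h₃^ε ω₂^{j+n−1} ω_{4n+2} and φ(h₃^ε ω₂^j ω₆^n ω₄) = b_{n+1} · h₃^ε ω₂^{j+n} ω_{4n+4} for n ≥ 1, where a₁ = b₁ = 1, b_n = (2n−1)a_{n−1}, a_n = n·b_n for n ≥ 2), for every p ∈ ℕ the basis element ω_{2p+8} of T (the element h₃^ε ω₂^j ω_{2p+8} with ε = 0 and j = 0) does not lie in the image of φ. -/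
/-!
# Statement 13

With the coefficient sequences `a₁ = b₁ = 1`, `b_n = (2n−1)·a_{n−1}`, `a_n = n·b_n`
(`n ≥ 2`), the injective cochain map `φ : S → T` modelling the fiberwise stabilized
adjunction unit does not hit the basis elements `ω_{2p+8}` of `T`: for every `p ∈ ℕ`
the element `ω_{2p+8}` does not lie in the image of `φ`.

Both complexes are concentrated in non-negative degrees, so they are indexed by `ℕ`,
and the map is given degreewise; `ω_{2p+8}` is homogeneous of degree `2p + 8`.
-/

noncomputable section

namespace Stmt13

/-! ## The complex `S` -/

/-- Index for the basis of `S`: `(knd, ε, j, m)`; `knd = false` encodes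
`h₃^ε ω₂^j ω₆^m`, and `knd = true` encodes `h₃^ε ω₂^j ω₆^m ω₄`. -/
abbrev SIdx : Type := Bool × Bool × ℕ × ℕ

/-- Degree of a basis symbol of `S`. -/
def Sdeg : SIdx → ℕ :=
  fun q => 3 * q.2.1.toNat + 2 * q.2.2.1 + 6 * q.2.2.2 + 4 * q.1.toNat

/-- Basis of the degree-`n` component of `S`. -/
abbrev SB (n : ℕ) : Type := {q : SIdx // Sdeg q = n}

/-- The degree-`n` component of `S`. -/
abbrev SV (n : ℕ) : Type := SB n →₀ ℚ

/-- The differential of `S` on basis elements. -/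
def SdTarget (n : ℕ) : SB n → SV (n + 1) := fun b =>
  match b with
  | ⟨(false, false, _, 0), _⟩ => 0
  | ⟨(false, false, j, m + 1), h⟩ =>
      ((m : ℚ) + 1) •
        Finsupp.single ⟨(true, true, j, m), by simp [Sdeg] at h ⊢; omega⟩ 1
  | ⟨(true, false, j, m), h⟩ =>
      (2 * (m : ℚ) + 1) •
        Finsupp.single ⟨(false, true, j + 1, m), by simp [Sdeg] at h ⊢; omega⟩ 1
  | ⟨(_, true, _, _), _⟩ => 0

/-- The differential of `S`. -/
def Sd (n : ℕ) : SV n →ₗ[ℚ] SV (n + 1) :=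
  Finsupp.linearCombination ℚ (SdTarget n)

/-! ## The complex `T` -/

/-- Index for the basis of `T`: `(knd, ε, j, p)`; `knd = true` encodes
`h₃^ε ω₂^j ω̃_{2p}`, and `knd = false` encodes `h₃^ε ω₂^j ω_{2p+4}`. -/
abbrev TIdx : Type := Bool × Bool × ℕ × ℕ

/-- Degree of a basis symbol of `T`. -/
def Tdeg : TIdx → ℕ :=
  fun q => 3 * q.2.1.toNat + 2 * q.2.2.1 + 2 * q.2.2.2 + 4 * (!q.1).toNat

/-- Basis of the degree-`n` component of `T`. -/
abbrev TB (n : ℕ) : Type := {q : TIdx // Tdeg q = n}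

/-- The degree-`n` component of `T`. -/
abbrev TV (n : ℕ) : Type := TB n →₀ ℚ

/-- The differential of `T` on basis elements. -/
def TdTarget (n : ℕ) : TB n → TV (n + 1) := fun b =>
  match b with
  | ⟨(true, false, _, 0), _⟩ => 0
  | ⟨(true, false, j, p + 1), h⟩ =>
      Finsupp.single ⟨(true, true, j, p), by simp [Tdeg] at h ⊢; omega⟩ 1
  | ⟨(false, false, j, 0), h⟩ =>
      Finsupp.single ⟨(true, true, j + 1, 0), by simp [Tdeg] at h ⊢; omega⟩ 1
  | ⟨(false, false, j, p + 1), h⟩ =>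
      Finsupp.single ⟨(false, true, j, p), by simp [Tdeg] at h ⊢; omega⟩ 1
  | ⟨(_, true, _, _), _⟩ => 0

/-- The differential of `T`. -/
def Td (n : ℕ) : TV n →ₗ[ℚ] TV (n + 1) :=
  Finsupp.linearCombination ℚ (TdTarget n)

/-! ## The map `φ` and its coefficient sequences -/

/-- The sequence `a` : `a₁ = 1` and `a_n = n·b_n = n·(2n−1)·a_{n−1}` for `n ≥ 2`. -/
def aseq : ℕ → ℚ
  | 0 => 1
  | 1 => 1
  | n + 2 => ((n : ℚ) + 2) * ((2 * ((n : ℚ) + 2) - 1) * aseq (n + 1))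

/-- The sequence `b` : `b₁ = 1` and `b_n = (2n−1)·a_{n−1}` for `n ≥ 2`. -/
def bseq : ℕ → ℚ
  | 0 => 1
  | 1 => 1
  | n + 2 => (2 * ((n : ℚ) + 2) - 1) * aseq (n + 1)

/-- `φ` on basis elements:
`φ(h₃^ε ω₂^j) = h₃^ε ω₂^j ω̃₀`, `φ(h₃^ε ω₂^j ω₄) = h₃^ε ω₂^j ω₄`,
`φ(h₃^ε ω₂^j ω₆^n) = a_n · h₃^ε ω₂^{j+n−1} ω_{4n+2}` for `n ≥ 1`, and
`φ(h₃^ε ω₂^j ω₆^n ω₄) = b_{n+1} · h₃^ε ω₂^{j+n} ω_{4n+4}` for `n ≥ 1`. -/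
def phiTarget (n : ℕ) : SB n → TV n := fun q =>
  match q with
  | ⟨(false, ε, j, 0), h⟩ =>
      Finsupp.single ⟨(true, ε, j, 0), by simp [Sdeg, Tdeg] at h ⊢; omega⟩ 1
  | ⟨(false, ε, j, m + 1), h⟩ =>
      aseq (m + 1) •
        Finsupp.single ⟨(false, ε, j + m, 2 * m + 1), by
          simp [Sdeg, Tdeg] at h ⊢; omega⟩ 1
  | ⟨(true, ε, j, 0), h⟩ =>
      Finsupp.single ⟨(false, ε, j, 0), by simp [Sdeg, Tdeg] at h ⊢; omega⟩ 1
  | ⟨(true, ε, j, m + 1), h⟩ =>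
      bseq (m + 2) •
        Finsupp.single ⟨(false, ε, j + m + 1, 2 * m + 2), by
          simp [Sdeg, Tdeg] at h ⊢; omega⟩ 1

/-- The ℚ-linear map `φ : S → T` (degreewise). -/
def phi (n : ℕ) : SV n →ₗ[ℚ] TV n :=
  Finsupp.linearCombination ℚ (phiTarget n)

/-- The basis element `ω_{2p+8}` of `T` (i.e. `h₃^ε ω₂^j ω_{2p+8}` with `ε = 0`,
`j = 0`), homogeneous of degree `2p + 8`. -/
def om (p : ℕ) : TV (2 * p + 8) :=
  Finsupp.single ⟨(false, false, 0, p + 2), by simp [Tdeg]; try omega⟩ 1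

/-- For every `p ∈ ℕ`, the basis element `ω_{2p+8}` of `T` does
not lie in the image of the fiberwise stabilized adjunction-unit map `φ`. -/
theorem statement13 :
    ∀ (p : ℕ) (x : SV (2 * p + 8)), phi (2 * p + 8) x ≠ om p := by
  intro p x hx
  have hdeg : Tdeg (false, false, 0, p + 2) = 2 * p + 8 := by simp [Tdeg]; try omega
  -- every basis image has vanishing coefficient at `ω_{2p+8}`
  have key : ∀ b : SB (2 * p + 8),
      phiTarget (2 * p + 8) b ⟨(false, false, 0, p + 2), hdeg⟩ = 0 := by
    rintro ⟨⟨k, ε, j, m⟩, h⟩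
    rcases k with _ | _ <;> rcases m with _ | m <;>
      simp only [phiTarget, Finsupp.smul_apply, smul_eq_mul]
    all_goals
      rw [Finsupp.single_apply, if_neg (by
        intro e
        have he := congrArg Subtype.val e
        simp only [Prod.mk.injEq] at he
        omega)]
      try simp
  have h0 : phi (2 * p + 8) x ⟨(false, false, 0, p + 2), hdeg⟩ = 0 := by
    rw [phi, Finsupp.linearCombination_apply, Finsupp.sum, Finsupp.finsetSum_apply]
    exact Finset.sum_eq_zero fun b _ => by
      rw [Finsupp.smul_apply, key, smul_zero]
  rw [hx] at h0
  simp [om] at h0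

end Stmt13
end
end

section
/- Let ψ : S → T be any ℚ-linear cochain map (ψ ∘ d = d ∘ ψ) which commutes with the multiplication operators h₃· and ω₂· on S and T, and which satisfies Θ ∘ ψ = v, where v : S → A is the ℚ-linear map with v(ω₂^j) = ω₂^j, v(ω₂^j ω₄) = ω₂^j ω₄, and v = 0 on all other basis elements of S. Then necessarily ψ(1) = ω̃₀, ψ(ω₂^j) = ω₂^j ω̃₀ for all j, ψ(ω₄) = ω₄, and ψ(ω₆) = ω₆ (where in T, ω₆ denotes the basis element ω_{2p+4} with p = 1, j = 0, ε = 0). That is, the values of the fiberwise stabilized adjunction-unit model on the generators ω₂, ω₄, ω₆ are uniquely determined. -/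
/-!
# Statement 14

Any degreewise ℚ-linear cochain map `ψ : S → T` which commutes with the
multiplication operators `h₃·` and `ω₂·` and satisfies `Θ ∘ ψ = v` necessarily has
`ψ(1) = ω̃₀`, `ψ(ω₂^j) = ω₂^j ω̃₀`, `ψ(ω₄) = ω₄` and `ψ(ω₆) = ω₆`.

All complexes are concentrated in non-negative degrees, so they are indexed by `ℕ`,
and all maps are given degreewise.
-/

noncomputable section

namespace Stmt14

/-! ## The complex `S` -/

/-- Index for the basis of `S`: `(knd, ε, j, m)`; `knd = false` encodes
`h₃^ε ω₂^j ω₆^m`, and `knd = true` encodes `h₃^ε ω₂^j ω₆^m ω₄`. -/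
abbrev SIdx : Type := Bool × Bool × ℕ × ℕ

/-- Degree of a basis symbol of `S`. -/
def Sdeg : SIdx → ℕ :=
  fun q => 3 * q.2.1.toNat + 2 * q.2.2.1 + 6 * q.2.2.2 + 4 * q.1.toNat

/-- Basis of the degree-`n` component of `S`. -/
abbrev SB (n : ℕ) : Type := {q : SIdx // Sdeg q = n}

/-- The degree-`n` component of `S`. -/
abbrev SV (n : ℕ) : Type := SB n →₀ ℚ

/-- The differential of `S` on basis elements. -/
def SdTarget (n : ℕ) : SB n → SV (n + 1) := fun b =>
  match b with
  | ⟨(false, false, _, 0), _⟩ => 0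
  | ⟨(false, false, j, m + 1), h⟩ =>
      ((m : ℚ) + 1) •
        Finsupp.single ⟨(true, true, j, m), by simp [Sdeg] at h ⊢; omega⟩ 1
  | ⟨(true, false, j, m), h⟩ =>
      (2 * (m : ℚ) + 1) •
        Finsupp.single ⟨(false, true, j + 1, m), by simp [Sdeg] at h ⊢; omega⟩ 1
  | ⟨(_, true, _, _), _⟩ => 0

/-- The differential of `S`. -/
def Sd (n : ℕ) : SV n →ₗ[ℚ] SV (n + 1) :=
  Finsupp.linearCombination ℚ (SdTarget n)

/-- The operator `h₃·` on `S`, sending a basis element with `ε = 0` to the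
corresponding one with `ε = 1`, and basis elements with `ε = 1` to `0`. -/
def hSTarget (n : ℕ) : SB n → SV (n + 3) := fun b =>
  match b with
  | ⟨(knd, false, j, m), h⟩ =>
      Finsupp.single ⟨(knd, true, j, m), by simp [Sdeg] at h ⊢; omega⟩ 1
  | ⟨(_, true, _, _), _⟩ => 0

/-- The operator `h₃·` on `S` (degreewise linear map of degree `3`). -/
def hS (n : ℕ) : SV n →ₗ[ℚ] SV (n + 3) :=
  Finsupp.linearCombination ℚ (hSTarget n)

/-- The operator `ω₂·` on `S`, raising the exponent `j` by `1`. -/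
def wSTarget (n : ℕ) : SB n → SV (n + 2) := fun b =>
  match b with
  | ⟨(knd, ε, j, m), h⟩ =>
      Finsupp.single ⟨(knd, ε, j + 1, m), by simp [Sdeg] at h ⊢; omega⟩ 1

/-- The operator `ω₂·` on `S` (degreewise linear map of degree `2`). -/
def wS (n : ℕ) : SV n →ₗ[ℚ] SV (n + 2) :=
  Finsupp.linearCombination ℚ (wSTarget n)

/-! ## The complex `T` -/

/-- Index for the basis of `T`: `(knd, ε, j, p)`; `knd = true` encodes
`h₃^ε ω₂^j ω̃_{2p}`, and `knd = false` encodes `h₃^ε ω₂^j ω_{2p+4}`. -/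
abbrev TIdx : Type := Bool × Bool × ℕ × ℕ

/-- Degree of a basis symbol of `T`. -/
def Tdeg : TIdx → ℕ :=
  fun q => 3 * q.2.1.toNat + 2 * q.2.2.1 + 2 * q.2.2.2 + 4 * (!q.1).toNat

/-- Basis of the degree-`n` component of `T`. -/
abbrev TB (n : ℕ) : Type := {q : TIdx // Tdeg q = n}

/-- The degree-`n` component of `T`. -/
abbrev TV (n : ℕ) : Type := TB n →₀ ℚ

/-- The differential of `T` on basis elements. -/
def TdTarget (n : ℕ) : TB n → TV (n + 1) := fun b =>
  match b with
  | ⟨(true, false, _, 0), _⟩ => 0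
  | ⟨(true, false, j, p + 1), h⟩ =>
      Finsupp.single ⟨(true, true, j, p), by simp [Tdeg] at h ⊢; omega⟩ 1
  | ⟨(false, false, j, 0), h⟩ =>
      Finsupp.single ⟨(true, true, j + 1, 0), by simp [Tdeg] at h ⊢; omega⟩ 1
  | ⟨(false, false, j, p + 1), h⟩ =>
      Finsupp.single ⟨(false, true, j, p), by simp [Tdeg] at h ⊢; omega⟩ 1
  | ⟨(_, true, _, _), _⟩ => 0

/-- The differential of `T`. -/
def Td (n : ℕ) : TV n →ₗ[ℚ] TV (n + 1) :=
  Finsupp.linearCombination ℚ (TdTarget n)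

/-- The operator `h₃·` on `T`. -/
def hTTarget (n : ℕ) : TB n → TV (n + 3) := fun b =>
  match b with
  | ⟨(knd, false, j, p), h⟩ =>
      Finsupp.single ⟨(knd, true, j, p), by simp [Tdeg] at h ⊢; omega⟩ 1
  | ⟨(_, true, _, _), _⟩ => 0

/-- The operator `h₃·` on `T` (degreewise linear map of degree `3`). -/
def hT (n : ℕ) : TV n →ₗ[ℚ] TV (n + 3) :=
  Finsupp.linearCombination ℚ (hTTarget n)

/-- The operator `ω₂·` on `T`, raising the exponent `j` by `1`. -/
def wTTarget (n : ℕ) : TB n → TV (n + 2) := fun b =>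
  match b with
  | ⟨(knd, ε, j, p), h⟩ =>
      Finsupp.single ⟨(knd, ε, j + 1, p), by simp [Tdeg] at h ⊢; omega⟩ 1

/-- The operator `ω₂·` on `T` (degreewise linear map of degree `2`). -/
def wT (n : ℕ) : TV n →ₗ[ℚ] TV (n + 2) :=
  Finsupp.linearCombination ℚ (wTTarget n)

/-! ## The complex `A`, and the maps `Θ : T → A` and `v : S → A` -/

/-- Index for the basis of `A`: `(β, i, j)`; `β = false` encodes `ω₂^i ω₄^j`,
and `β = true` encodes `ω₂^i ω₄^j h₇`. -/
abbrev AIdx : Type := Bool × ℕ × ℕ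

/-- Degree of a basis symbol of `A`. -/
def Adeg : AIdx → ℕ := fun q => 2 * q.2.1 + 4 * q.2.2 + 7 * q.1.toNat

/-- Basis of the degree-`n` component of `A`. -/
abbrev AB (n : ℕ) : Type := {q : AIdx // Adeg q = n}

/-- The degree-`n` component of `A`. -/
abbrev AV (n : ℕ) : Type := AB n →₀ ℚ

/-- The differential of `A` on basis elements:
`d(ω₂^i ω₄^j) = 0` and `d(ω₂^i ω₄^j h₇) = −(1/2) ω₂^i ω₄^{j+2}`. -/
def AdTarget (n : ℕ) : AB n → AV (n + 1) := fun b =>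
  match b with
  | ⟨(false, _, _), _⟩ => 0
  | ⟨(true, i, j), h⟩ =>
      Finsupp.single ⟨(false, i, j + 2), by simp [Adeg] at h ⊢; omega⟩ (-(1 / 2) : ℚ)

/-- The differential of `A`. -/
def Ad (n : ℕ) : AV n →ₗ[ℚ] AV (n + 1) :=
  Finsupp.linearCombination ℚ (AdTarget n)

/-- `Θ` on basis elements: `Θ(ω₂^j ω̃₀) = ω₂^j`, `Θ(ω₂^j ω₄) = ω₂^j ω₄`,
and `Θ = 0` on every other basis element of `T`. -/
def ThetaTarget (n : ℕ) : TB n → AV n := fun b =>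
  match b with
  | ⟨(true, false, j, 0), h⟩ =>
      Finsupp.single ⟨(false, j, 0), by simp [Tdeg, Adeg] at h ⊢; omega⟩ 1
  | ⟨(false, false, j, 0), h⟩ =>
      Finsupp.single ⟨(false, j, 1), by simp [Tdeg, Adeg] at h ⊢; omega⟩ 1
  | _ => 0

/-- The ℚ-linear map `Θ : T → A` (degreewise). -/
def Theta (n : ℕ) : TV n →ₗ[ℚ] AV n :=
  Finsupp.linearCombination ℚ (ThetaTarget n)

/-- `v` on basis elements: `v(ω₂^j) = ω₂^j`, `v(ω₂^j ω₄) = ω₂^j ω₄`,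
and `v = 0` on every other basis element of `S`. -/
def vTarget (n : ℕ) : SB n → AV n := fun b =>
  match b with
  | ⟨(false, false, j, 0), h⟩ =>
      Finsupp.single ⟨(false, j, 0), by simp [Sdeg, Adeg] at h ⊢; omega⟩ 1
  | ⟨(true, false, j, 0), h⟩ =>
      Finsupp.single ⟨(false, j, 1), by simp [Sdeg, Adeg] at h ⊢; omega⟩ 1
  | _ => 0

/-- The ℚ-linear map `v : S → A` (degreewise). -/
def v (n : ℕ) : SV n →ₗ[ℚ] AV n :=
  Finsupp.linearCombination ℚ (vTarget n)

/-! ## Distinguished basis elements -/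

/-- `1 = ω₂^0 ∈ S` in degree `0`. -/
def sOne : SV 0 := Finsupp.single ⟨(false, false, 0, 0), by simp [Sdeg]⟩ 1
/-- `ω₂^j ∈ S` in degree `2j`. -/
def sW2pow (j : ℕ) : SV (2 * j) :=
  Finsupp.single ⟨(false, false, j, 0), by simp [Sdeg]; try omega⟩ 1
/-- `ω₄ ∈ S` in degree `4`. -/
def sW4 : SV 4 := Finsupp.single ⟨(true, false, 0, 0), by simp [Sdeg]⟩ 1
/-- `ω₆ ∈ S` in degree `6`. -/
def sW6 : SV 6 := Finsupp.single ⟨(false, false, 0, 1), by simp [Sdeg]⟩ 1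
/-- `ω̃₀ ∈ T` in degree `0`. -/
def tTilde0 : TV 0 := Finsupp.single ⟨(true, false, 0, 0), by simp [Tdeg]⟩ 1
/-- `ω₂^j ω̃₀ ∈ T` in degree `2j`. -/
def tW2powTilde0 (j : ℕ) : TV (2 * j) :=
  Finsupp.single ⟨(true, false, j, 0), by simp [Tdeg]; try omega⟩ 1
/-- `ω₄ ∈ T` (the basis element `ω_{2p+4}` with `p = 0`, `j = 0`, `ε = 0`). -/
def tW4 : TV 4 := Finsupp.single ⟨(false, false, 0, 0), by simp [Tdeg]⟩ 1
/-- `ω₆ ∈ T` (the basis element `ω_{2p+4}` with `p = 1`, `j = 0`, `ε = 0`). -/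
def tW6 : TV 6 := Finsupp.single ⟨(false, false, 0, 1), by simp [Tdeg]⟩ 1

theorem Theta_coeff_tilde (n j : ℕ) (x : TV n) (h : Tdeg (true, false, j, 0) = n)
    (h' : Adeg (false, j, 0) = n) :
    Theta n x ⟨(false, j, 0), h'⟩ = x ⟨(true, false, j, 0), h⟩ := by
  induction x using Finsupp.induction_linear with
  | zero => simp
  | add f g hf hg => simp [hf, hg]
  | single b c =>
    rcases b with ⟨⟨_ | _, _ | _, i, _ | p⟩, hb⟩ <;>
      simp [Theta, ThetaTarget, Finsupp.single_apply]

theorem Theta_coeff_w4 (n j : ℕ) (x : TV n) (h : Tdeg (false, false, j, 0) = n)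
    (h' : Adeg (false, j, 1) = n) :
    Theta n x ⟨(false, j, 1), h'⟩ = x ⟨(false, false, j, 0), h⟩ := by
  induction x using Finsupp.induction_linear with
  | zero => simp
  | add f g hf hg => simp [hf, hg]
  | single b c =>
    rcases b with ⟨⟨_ | _, _ | _, i, _ | p⟩, hb⟩ <;>
      simp [Theta, ThetaTarget, Finsupp.single_apply]

theorem Td_coeff_w (n j p : ℕ) (x : TV n) (h : Tdeg (false, false, j, p + 1) = n)
    (h' : Tdeg (false, true, j, p) = n + 1) :
    Td n x ⟨(false, true, j, p), h'⟩ = x ⟨(false, false, j, p + 1), h⟩ := by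
  induction x using Finsupp.induction_linear with
  | zero => simp
  | add f g hf hg => simp [hf, hg]
  | single b c =>
    rcases b with ⟨⟨_ | _, _ | _, i, _ | p⟩, hb⟩ <;>
      simp [Td, TdTarget, Finsupp.single_apply]

theorem Td_coeff_tilde_zero (n p : ℕ) (x : TV n) (h : Tdeg (true, false, 0, p + 1) = n)
    (h' : Tdeg (true, true, 0, p) = n + 1) :
    Td n x ⟨(true, true, 0, p), h'⟩ = x ⟨(true, false, 0, p + 1), h⟩ := by
  induction x using Finsupp.induction_linear with
  | zero => simp
  | add f g hf hg => simp [hf, hg]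
  | single b c =>
    rcases b with ⟨⟨_ | _, _ | _, i, _ | p⟩, hb⟩ <;>
      simp [Td, TdTarget, Finsupp.single_apply]

theorem Td_coeff_tilde_succ (n j p : ℕ) (x : TV n) (h : Tdeg (true, false, j, p + 2) = n)
    (h' : Tdeg (true, true, j, p + 1) = n + 1) :
    Td n x ⟨(true, true, j, p + 1), h'⟩ = x ⟨(true, false, j, p + 2), h⟩ := by
  induction x using Finsupp.induction_linear with
  | zero => simp
  | add f g hf hg => simp [hf, hg]
  | single b c =>
    rcases b with ⟨⟨_ | _, _ | _, i, _ | p⟩, hb⟩ <;>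
      simp [Td, TdTarget, Finsupp.single_apply]

theorem Td_coeff_tilde_mixed (n j : ℕ) (x : TV n) (h : Tdeg (true, false, j + 1, 1) = n)
    (h2 : Tdeg (false, false, j, 0) = n) (h' : Tdeg (true, true, j + 1, 0) = n + 1) :
    Td n x ⟨(true, true, j + 1, 0), h'⟩ =
      x ⟨(true, false, j + 1, 1), h⟩ + x ⟨(false, false, j, 0), h2⟩ := by
  induction x using Finsupp.induction_linear with
  | zero => simp
  | add f g hf hg => simp [hf, hg]; ring
  | single b c =>
    rcases b with ⟨⟨_ | _, _ | _, i, _ | p⟩, hb⟩ <;>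
      simp [Td, TdTarget, Finsupp.single_apply]

/-- In even degrees, `Θ` and `d` are jointly injective on `T`. -/
theorem eq_zero_of (m : ℕ) (x : TV (2 * m)) (h1 : Theta _ x = 0) (h2 : Td _ x = 0) : x = 0 := by
  ext ⟨⟨k, e, j, p⟩, hb⟩
  have hb' := hb
  rcases e with _ | _
  · rcases k with _ | _
    · rcases p with _ | p
      · rw [← Theta_coeff_w4 _ j x hb (by simp [Tdeg, Adeg] at hb' ⊢; omega), h1]; rfl
      · rw [← Td_coeff_w _ j p x hb (by simp [Tdeg] at hb' ⊢; omega), h2]; rfl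
    · rcases p with _ | _ | p
      · rw [← Theta_coeff_tilde _ j x hb (by simp [Tdeg, Adeg] at hb' ⊢; omega), h1]; rfl
      · rcases j with _ | j
        · rw [← Td_coeff_tilde_zero _ 0 x hb (by simp [Tdeg] at hb' ⊢; omega), h2]; rfl
        · have hc : Tdeg (false, false, j, 0) = 2 * m := by simp [Tdeg] at hb' ⊢; omega
          have e1 := Td_coeff_tilde_mixed _ j x hb hc (by simp [Tdeg] at hb' ⊢; omega)
          have e2 := Theta_coeff_w4 _ j x hc (by simp [Tdeg, Adeg] at hb' ⊢; omega)
          rw [h1] at e2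
          rw [h2, ← e2] at e1
          simpa using e1.symm
      · rw [← Td_coeff_tilde_succ _ j p x hb (by simp [Tdeg] at hb' ⊢; omega), h2]; rfl
  · exfalso
    simp [Tdeg] at hb'
    omega

theorem eq_of (m : ℕ) (x y : TV (2 * m)) (h1 : Theta _ x = Theta _ y) (h2 : Td _ x = Td _ y) :
    x = y := by
  rw [← sub_eq_zero]
  apply eq_zero_of m <;> simp [h1, h2]

/-- Let `ψ : S → T` be any ℚ-linear cochain map commuting with the
multiplication operators `h₃·` and `ω₂·` on `S` and `T`, and satisfying `Θ ∘ ψ = v`.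
Then necessarily `ψ(1) = ω̃₀`, `ψ(ω₂^j) = ω₂^j ω̃₀` for all `j`, `ψ(ω₄) = ω₄`, and
`ψ(ω₆) = ω₆`: the values of the fiberwise stabilized adjunction-unit model on the
generators `ω₂, ω₄, ω₆` are uniquely determined. -/
theorem statement14 (ψ : ∀ n : ℕ, SV n →ₗ[ℚ] TV n)
    (hd : ∀ (n : ℕ) (x : SV n), ψ (n + 1) (Sd n x) = Td n (ψ n x))
    (hh : ∀ (n : ℕ) (x : SV n), ψ (n + 3) (hS n x) = hT n (ψ n x))
    (hw : ∀ (n : ℕ) (x : SV n), ψ (n + 2) (wS n x) = wT n (ψ n x))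
    (hv : ∀ (n : ℕ) (x : SV n), Theta n (ψ n x) = v n x) :
    ψ 0 sOne = tTilde0 ∧
    (∀ j : ℕ, ψ (2 * j) (sW2pow j) = tW2powTilde0 j) ∧
    ψ 4 sW4 = tW4 ∧
    ψ 6 sW6 = tW6 := by
  have key : ∀ j : ℕ, ψ (2 * j) (sW2pow j) = tW2powTilde0 j := by
    intro j
    apply eq_of
    · rw [hv]; simp [v, Theta, sW2pow, tW2powTilde0, vTarget, ThetaTarget]
    · rw [← hd]; simp [Sd, Td, sW2pow, tW2powTilde0, SdTarget, TdTarget]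
  have h4 : ψ 4 sW4 = tW4 := by
    apply eq_of 2
    · refine (hv 4 _).trans ?_
      simp [v, Theta, sW4, tW4, vTarget, ThetaTarget]
    · refine (hd 4 _).symm.trans ?_
      have e : Sd 4 sW4 = hS 2 (sW2pow 1) := by
        simp [Sd, hS, sW4, sW2pow, SdTarget, hSTarget]
      have e' : Td 4 tW4 = hT 2 (tW2powTilde0 1) := by
        simp [Td, hT, tW4, tW2powTilde0, TdTarget, hTTarget]
      rw [e]
      exact (hh 2 _).trans ((congrArg (hT 2) (key 1)).trans e'.symm)
  refine ⟨key 0, key, h4, ?_⟩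
  apply eq_of 3
  · refine (hv 6 _).trans ?_
    simp [v, Theta, sW6, tW6, vTarget, ThetaTarget]
  · refine (hd 6 _).symm.trans ?_
    have e : Sd 6 sW6 = hS 4 sW4 := by
      simp [Sd, hS, sW4, sW6, SdTarget, hSTarget]
    have e' : Td 6 tW6 = hT 4 tW4 := by
      simp [Td, hT, tW4, tW6, TdTarget, hTTarget]
    rw [e]
    exact (hh 4 _).trans ((congrArg (hT 4) h4).trans e'.symm)

end Stmt14
end
end
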